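/- arXiv:2305.15995 — 4 statements merged into one kernel-verified Lean document; each statement's English description precedes it below -/
import Mathlib

section
/- Let (D, f_{1,∞}) be a non-autonomous discrete dynamical system on a compact metric space D. Then (D, f_{1,∞}) is multi-transitive if and only if for every natural number n ≥ 1 the n-th iterate system (D, (f_{1,∞})^n) is multi-transitive. -/
open Set

/-- The compositions of a non-autonomous system: `comps f n = fₙ ∘ ⋯ ∘ f₂ ∘ f₁`,
with `comps f 0 = id` (the map `f 0` is unused; the sequence is indexed from 1). -/
def comps {D : Type*} (f : ℕ → D → D) : ℕ → D → D
  | 0 => id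
  | n + 1 => f (n + 1) ∘ comps f n

/-- Multi-transitivity of the NDDS `f` with respect to the vector `a = (a 0, …, a (p-1))`. -/
def aTrans {D : Type*} [TopologicalSpace D] (f : ℕ → D → D) {p : ℕ} (a : Fin p → ℕ) : Prop :=
  ∀ A B : Fin p → Set D,
    (∀ i, IsOpen (A i)) → (∀ i, (A i).Nonempty) →
    (∀ i, IsOpen (B i)) → (∀ i, (B i).Nonempty) →
    ∃ m, 1 ≤ m ∧ ∀ i, (comps f (a i * m) '' A i ∩ B i).Nonempty

/-- An NDDS on a compact metric space is multi-transitive iff every `n`-th iterate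
system `(D, (f_{1,∞})^n)` is multi-transitive. -/
theorem multiTransitive_iff_iterates_multiTransitive
    {D : Type*} [MetricSpace D] [CompactSpace D]
    (f : ℕ → D → D) (hf : ∀ n, Continuous (f n)) :
    (∀ p : ℕ, 1 ≤ p → aTrans f (fun i : Fin p => (i : ℕ) + 1)) ↔
      (∀ n : ℕ, 1 ≤ n → ∀ p : ℕ, 1 ≤ p →
        aTrans f (fun i : Fin p => n * ((i : ℕ) + 1))) := by
  constructor
  · intro h n hn p hp A B hAo hAn hBo hBn
    let q : Fin (n * p) → Fin p := fun j => ⟨j / n, Nat.div_lt_of_lt_mul j.2⟩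
    obtain ⟨m, hm, hmeet⟩ := h (n * p) (Nat.mul_pos hn hp) (A ∘ q) (B ∘ q)
      (fun j => hAo (q j)) (fun j => hAn (q j)) (fun j => hBo (q j)) (fun j => hBn (q j))
    refine ⟨m, hm, fun i => ?_⟩
    have hlt : n * (i : ℕ) + (n - 1) < n * p := by
      have := Nat.mul_le_mul_left n (Nat.succ_le_of_lt i.2)
      rw [Nat.mul_succ] at this
      omega
    have hq : q ⟨n * i + (n - 1), hlt⟩ = i := by
      apply Fin.ext
      change (n * (i : ℕ) + (n - 1)) / n = i
      rw [Nat.mul_add_div hn, Nat.div_eq_of_lt (by omega), Nat.add_zero]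
    have hindex : n * (i : ℕ) + (n - 1) + 1 = n * (i + 1) := by
      rw [Nat.mul_succ]
      omega
    simpa only [Function.comp_apply, hq, hindex] using hmeet ⟨n * i + (n - 1), hlt⟩
  · intro h p hp
    simpa only [one_mul] using h 1 le_rfl p hp
end

section
/- Let (D, f_{1,∞}) be a non-autonomous discrete dynamical system on a compact metric space D and let k, n be positive integers. If (D, f_{1,∞}) is multi-transitive with respect to the vector (1, 2, …, kn), then the n-th iterate system (D, (f_{1,∞})^n) is multi-transitive with respect to the vector (1, 2, …, k); that is, for all nonempty open sets A_1,…,A_k, B_1,…,B_k ⊆ D there exists m ≥ 1 with f_1^{n i m}(A_i) ∩ B_i ≠ ∅ for every i = 1,…,k. -/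
open Set

/-- If an NDDS is multi-transitive with respect to `(1, 2, …, kn)`, then its `n`-th
iterate system is multi-transitive with respect to `(1, 2, …, k)`: for all nonempty
open `Aᵢ, Bᵢ ⊆ D` there is `m ≥ 1` with `f₁^{n i m}(Aᵢ) ∩ Bᵢ ≠ ∅` for `i = 1, …, k`. -/
theorem iterate_aTrans_of_aTrans_kn
    {D : Type*} [MetricSpace D] [CompactSpace D]
    (f : ℕ → D → D) (hf : ∀ n, Continuous (f n))
    (k n : ℕ) (hk : 1 ≤ k) (hn : 1 ≤ n)
    (h : aTrans f (fun i : Fin (k * n) => (i : ℕ) + 1)) :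
    ∀ A B : Fin k → Set D,
      (∀ i, IsOpen (A i)) → (∀ i, (A i).Nonempty) →
      (∀ i, IsOpen (B i)) → (∀ i, (B i).Nonempty) →
      ∃ m, 1 ≤ m ∧ ∀ i : Fin k, (comps f (n * (((i : ℕ) + 1) * m)) '' A i ∩ B i).Nonempty := by
  intro A B hAo hAn hBo hBn
  have hdiv (j : Fin (k * n)) : (j : ℕ) / n < k := Nat.div_lt_of_lt_mul (by
    rw [mul_comm n k]; exact j.isLt)
  obtain ⟨m, hm, H⟩ := h (fun j => A ⟨j / n, hdiv j⟩) (fun j => B ⟨j / n, hdiv j⟩)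
    (fun _ => hAo _) (fun _ => hAn _) (fun _ => hBo _) (fun _ => hBn _)
  refine ⟨m, hm, fun i => ?_⟩
  have hlt : n * (i : ℕ) + (n - 1) < k * n := by
    have : n * ((i : ℕ) + 1) ≤ n * k := Nat.mul_le_mul_left n i.isLt
    rw [mul_add, mul_one, mul_comm n k] at this
    omega
  have hquot : (n * (i : ℕ) + (n - 1)) / n = i := by
    rw [Nat.mul_add_div hn, Nat.div_eq_of_lt (by omega), add_zero]
  have htime : (n * (i : ℕ) + (n - 1) + 1) * m = n * (((i : ℕ) + 1) * m) := by
    rw [add_assoc, Nat.sub_add_cancel hn]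
    ring
  simpa only [hquot, htime] using H ⟨_, hlt⟩
end

section
/- Let Σ = {0,1}^ℤ be the two-sided full shift space with the product topology (equivalently, the metric d(x,t) = Σ_{i∈ℤ} |x_i − t_i| / 2^{|i|}), and let σ : Σ → Σ be the shift homeomorphism (σ(x))_i = x_{i+1}. Consider the non-autonomous discrete dynamical system (Σ, f_{1,∞}) given by the 3-periodic sequence f_1 = σ, f_2 = σ^{-4}, f_3 = σ^{4}, f_4 = σ, f_5 = σ^{-4}, f_6 = σ^{4}, and so on. Then (Σ, f_{1,∞}) is strongly multi-transitive: for every p ≥ 1, every vector (a_1,…,a_p) of positive integers, and all nonempty open sets A_1,…,A_p, B_1,…,B_p ⊆ Σ, there exists m ≥ 1 with f_1^{a_i m}(A_i) ∩ B_i ≠ ∅ for every i = 1,…,p. -/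
open Set

/-- The two-sided full shift space `Σ = {0,1}^ℤ` with the product topology. -/
abbrev FullShift : Type := ℤ → Bool

/-- The shift homeomorphism `(σ x)ᵢ = x_{i+1}`. -/
def shiftMap : FullShift → FullShift := fun x i => x (i + 1)

/-- The inverse shift `(σ⁻¹ x)ᵢ = x_{i-1}`. -/
def shiftInv : FullShift → FullShift := fun x i => x (i - 1)

/-- The 3-periodic sequence `f₁ = σ, f₂ = σ⁻⁴, f₃ = σ⁴, f₄ = σ, …`
(the value at index `0` is unused). -/
def fseq : ℕ → FullShift → FullShift := fun n =>
  if n % 3 = 1 then shiftMap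
  else if n % 3 = 2 then shiftInv^[4]
  else shiftMap^[4]

lemma iterate_shiftMap_apply (n : ℕ) (x : FullShift) (j : ℤ) :
    shiftMap^[n] x j = x (j + n) := by
  induction n generalizing x with
  | zero => simp
  | succ n ih =>
    rw [Function.iterate_succ_apply, ih]
    simp only [shiftMap]
    congr 1
    push_cast
    ring

lemma shiftMap_leftInverse_shiftInv : Function.LeftInverse shiftMap shiftInv := fun x => by
  funext j
  simp [shiftMap, shiftInv]

lemma comps_fseq_three_mul (n : ℕ) : comps fseq (3 * n) = shiftMap^[n] := by
  induction n with
  | zero => rfl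
  | succ n ih =>
    have h1 : (3 * n + 1) % 3 = 1 := by omega
    have h2 : (3 * n + 1 + 1) % 3 = 2 := by omega
    have h3 : (3 * n + 1 + 1 + 1) % 3 = 0 := by omega
    funext x
    rw [Function.iterate_succ_apply', ← ih]
    simp only [show 3 * (n + 1) = 3 * n + 1 + 1 + 1 by ring, comps, fseq, h1, h2, h3,
      Function.comp_apply, if_true, if_false, OfNat.ofNat_ne_one, zero_ne_one,
      (OfNat.zero_ne_ofNat 2 : (0 : ℕ) ≠ 2)]
    exact shiftMap_leftInverse_shiftInv.iterate 4 _

/-- Every neighbourhood of `x` contains all points agreeing with `x` on a large central block. -/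
lemma exists_central_cylinder_subset {U : Set FullShift} (hU : IsOpen U) {x : FullShift}
    (hx : x ∈ U) : ∃ N : ℕ, ∀ y : FullShift, (∀ j : ℤ, j.natAbs ≤ N → y j = x j) → y ∈ U := by
  obtain ⟨I, u, hu, hsub⟩ := isOpen_pi_iff.mp hU x hx
  refine ⟨I.sup Int.natAbs, fun y hy => hsub fun j hj => ?_⟩
  rw [hy j (Finset.le_sup (f := Int.natAbs) hj)]
  exact (hu j hj).2

/-- The NDDS on the two-sided full shift given by the 3-periodic sequence
`σ, σ⁻⁴, σ⁴, σ, σ⁻⁴, σ⁴, …` is strongly multi-transitive. -/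
theorem fullShift_system_stronglyMultiTransitive :
    ∀ p : ℕ, 1 ≤ p → ∀ a : Fin p → ℕ, (∀ i, 1 ≤ a i) →
    ∀ A B : Fin p → Set FullShift,
      (∀ i, IsOpen (A i)) → (∀ i, (A i).Nonempty) →
      (∀ i, IsOpen (B i)) → (∀ i, (B i).Nonempty) →
      ∃ m, 1 ≤ m ∧ ∀ i, (comps fseq (a i * m) '' A i ∩ B i).Nonempty := by
  intro p _ a ha A B hA hAne hB hBne
  choose u hu using hAne
  choose v hv using hBne
  choose M hM using fun i => exists_central_cylinder_subset (hA i) (hu i)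
  choose N hN using fun i => exists_central_cylinder_subset (hB i) (hv i)
  set K := Finset.univ.sup M + Finset.univ.sup N + 1 with hK
  refine ⟨3 * K, by omega, fun i => ?_⟩
  have hMi : M i ≤ Finset.univ.sup M := Finset.le_sup (Finset.mem_univ i)
  have hNi : N i ≤ Finset.univ.sup N := Finset.le_sup (Finset.mem_univ i)
  have hlt : M i + N i < a i * K := by
    have := Nat.mul_le_mul_right K (ha i)
    omega
  let x : FullShift := fun j => if j.natAbs ≤ M i then u i j else v i (j - (a i * K : ℕ))
  refine ⟨_, ⟨x, hM i x fun j hj => if_pos hj, rfl⟩, hN i _ fun j hj => ?_⟩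
  rw [show a i * (3 * K) = 3 * (a i * K) by ring, comps_fseq_three_mul, iterate_shiftMap_apply]
  have hj' : ¬ (j + (a i * K : ℕ)).natAbs ≤ M i := by omega
  simp only [x, if_neg hj', add_sub_cancel_right]
end

section
/- Let Σ = {0,1}^ℤ be the two-sided full shift space with the product topology, let σ : Σ → Σ be the shift homeomorphism (σ(x))_i = x_{i+1}, and let (Σ, f_{1,∞}) be the non-autonomous discrete dynamical system given by the 3-periodic sequence f_1 = σ, f_2 = σ^{-4}, f_3 = σ^{4}, repeated. Then (Σ, f_{1,∞}) is weakly mixing: for all nonempty open sets A_1, A_2, B_1, B_2 ⊆ Σ there exists n ≥ 1 with f_1^{n}(A_1) ∩ B_1 ≠ ∅ and f_1^{n}(A_2) ∩ B_2 ≠ ∅. -/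
open Set

/-- The composition of the first `3m` maps is `σ^m`. -/
theorem comps_fseq_three_mul_s14 (m : ℕ) (x : FullShift) (i : ℤ) :
    comps fseq (3 * m) x i = x (i + m) := by
  induction m generalizing i with
  | zero => simp [comps]
  | succ m ih =>
    have h₁ : fseq (3 * m + 1) = shiftMap := by
      rw [fseq, if_pos (by lia)]
    have h₂ : fseq (3 * m + 1 + 1) = shiftInv^[4] := by
      rw [fseq, if_neg (by lia), if_pos (by lia)]
    have h₃ : fseq (3 * m + 1 + 1 + 1) = shiftMap^[4] := by
      rw [fseq, if_neg (by lia), if_neg (by lia)]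
    change comps fseq (3 * m + 1 + 1 + 1) x i = _
    rw [comps, comps, comps, h₁, h₂, h₃]
    simp only [Function.comp_apply, Function.iterate_succ, Function.iterate_zero, id_eq,
      shiftMap, shiftInv, ih]
    congr 1
    push_cast
    ring

/-- A nonempty open subset of the full shift contains a centred cylinder. -/
theorem exists_cylinder_subset {A : Set FullShift} (hA : IsOpen A) (hne : A.Nonempty) :
    ∃ (x : FullShift) (N : ℕ), ∀ y : FullShift, (∀ i : ℤ, |i| ≤ N → y i = x i) → y ∈ A := by
  obtain ⟨x, hx⟩ := hne
  obtain ⟨I, u, hu, hsub⟩ := isOpen_pi_iff.mp hA x hx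
  refine ⟨x, I.sup Int.natAbs, fun y hy => hsub fun i hi => ?_⟩
  have hle : i.natAbs ≤ I.sup Int.natAbs := Finset.le_sup (f := Int.natAbs) hi
  rw [hy i (by rw [Int.abs_eq_natAbs]; exact_mod_cast hle)]
  exact (hu i hi).2

/-- The system on the full shift is mixing along the multiples of `3`. -/
theorem eventually_comps_fseq_image_inter_nonempty {A B : Set FullShift}
    (hA : IsOpen A) (hA' : A.Nonempty) (hB : IsOpen B) (hB' : B.Nonempty) :
    ∀ᶠ m : ℕ in Filter.atTop, (comps fseq (3 * m) '' A ∩ B).Nonempty := by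
  obtain ⟨a, N, ha⟩ := exists_cylinder_subset hA hA'
  obtain ⟨b, M, hb⟩ := exists_cylinder_subset hB hB'
  filter_upwards [Filter.eventually_gt_atTop (N + M)] with m hm
  refine ⟨_, ⟨fun i => if i ≤ N then a i else b (i - m), ha _ fun i hi => ?_, rfl⟩,
    hb _ fun i hi => ?_⟩
  · exact if_pos (abs_le.mp hi).2
  · have := (abs_le.mp hi).1
    rw [comps_fseq_three_mul_s14, if_neg (by lia), add_sub_cancel_right]

/-- The NDDS on the two-sided full shift given by the 3-periodic sequence
`σ, σ⁻⁴, σ⁴, σ, σ⁻⁴, σ⁴, …` is weakly mixing. -/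
theorem fullShift_system_weaklyMixing :
    ∀ A₁ A₂ B₁ B₂ : Set FullShift,
      IsOpen A₁ → A₁.Nonempty → IsOpen A₂ → A₂.Nonempty →
      IsOpen B₁ → B₁.Nonempty → IsOpen B₂ → B₂.Nonempty →
      ∃ n, 1 ≤ n ∧ (comps fseq n '' A₁ ∩ B₁).Nonempty ∧
        (comps fseq n '' A₂ ∩ B₂).Nonempty := by
  intro A₁ A₂ B₁ B₂ hA₁ hA₁' hA₂ hA₂' hB₁ hB₁' hB₂ hB₂'
  obtain ⟨m, h₁, h₂, hm⟩ :=
    ((eventually_comps_fseq_image_inter_nonempty hA₁ hA₁' hB₁ hB₁').and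
      ((eventually_comps_fseq_image_inter_nonempty hA₂ hA₂' hB₂ hB₂').and
        (Filter.eventually_ge_atTop 1))).exists
  exact ⟨3 * m, by lia, h₁, h₂⟩
end
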